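/- For i = 1, 2, let T_i be a closed, densely defined linear operator from a Hilbert space H_i to a Hilbert space H_i′, and let T₁ ⊗ T₂ denote the closure of the algebraic tensor product operator. Then T₁ ⊗ T₂ equals the closure of the composition (T₁ ⊗ I_{H₂})(I_{H₁} ⊗ T₂). If, moreover, T₁ is injective with bounded inverse (on its range), or T₂ is bounded, then (T₁ ⊗ I_{H₂})(I_{H₁} ⊗ T₂) is closed, and hence T₁ ⊗ T₂ = (T₁ ⊗ I_{H₂})(I_{H₁} ⊗ T₂). -/

import Mathlib

open scoped ComplexInnerProductSpace

/-!
STATEMENT 18.  For `i = 1, 2` let `Tᵢ` be a closed densely defined operator from `Hᵢ` to `Hᵢ'`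
and let `T₁ ⊗ T₂` denote the closure of the algebraic tensor product operator.  Then
`T₁ ⊗ T₂ = closure ((T₁ ⊗ I)(I ⊗ T₂))`.  If moreover `T₁` is injective with bounded inverse,
or `T₂` is bounded, then `(T₁ ⊗ I)(I ⊗ T₂)` is closed, so `T₁ ⊗ T₂ = (T₁ ⊗ I)(I ⊗ T₂)`.
The tensor products involved are `GA = H₁ ⊗ H₂`, `GB = H₁ ⊗ H₂'`, `GC = H₁' ⊗ H₂'`, realised
abstractly, and closures of algebraic tensor operators are characterised via their graphs.
-/

/-- Composition of two partially defined linear operators, with its natural domain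
`{x ∈ Dom P : P x ∈ Dom Q}`; it is defined through its graph. -/
noncomputable def pmapComp {E F G : Type*}
    [NormedAddCommGroup E] [InnerProductSpace ℂ E]
    [NormedAddCommGroup F] [InnerProductSpace ℂ F]
    [NormedAddCommGroup G] [InnerProductSpace ℂ G]
    (Q : F →ₗ.[ℂ] G) (P : E →ₗ.[ℂ] F) : E →ₗ.[ℂ] G :=
  Submodule.toLinearPMap
    { carrier := {p : E × G | ∃ y : F, (p.1, y) ∈ P.graph ∧ (y, p.2) ∈ Q.graph}
      add_mem' := by
        rintro a b ⟨y₁, h₁, h₂⟩ ⟨y₂, h₃, h₄⟩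
        exact ⟨y₁ + y₂, by simpa using add_mem h₁ h₃, by simpa using add_mem h₂ h₄⟩
      zero_mem' := ⟨0, zero_mem _, zero_mem _⟩
      smul_mem' := by
        rintro c a ⟨y, h₁, h₂⟩
        exact ⟨c • y, by simpa using Submodule.smul_mem _ c h₁,
          by simpa using Submodule.smul_mem _ c h₂⟩ }

open scoped TensorProduct

section TensorBound

variable {E H K M G G' : Type*} [AddCommGroup E] [Module ℂ E]
  [NormedAddCommGroup H] [InnerProductSpace ℂ H]
  [NormedAddCommGroup K] [InnerProductSpace ℂ K]
  [NormedAddCommGroup M] [InnerProductSpace ℂ M]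
  [NormedAddCommGroup G] [InnerProductSpace ℂ G]
  [NormedAddCommGroup G'] [InnerProductSpace ℂ G']

lemma norm_sq_sum_tensor_orthonormal {ι : Type*} [Fintype ι] (tm : H →ₗ[ℂ] M →ₗ[ℂ] G)
    (htm : ∀ (a c : H) (b d : M), ⟪tm a b, tm c d⟫ = ⟪a, c⟫ * ⟪b, d⟫)
    {u : ι → M} (hu : Orthonormal ℂ u) (h : ι → H) :
    ‖∑ i, tm (h i) (u i)‖ ^ 2 = ∑ i, ‖h i‖ ^ 2 := by
  classical
  have key : ⟪∑ i, tm (h i) (u i), ∑ i, tm (h i) (u i)⟫ = ∑ i, ⟪h i, h i⟫ := by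
    simp only [sum_inner, inner_sum, htm, orthonormal_iff_ite.mp hu]
    simp
  simp only [inner_self_eq_norm_sq_to_K] at key
  exact_mod_cast key

lemma norm_lift_le_of_norm_le (tm : H →ₗ[ℂ] M →ₗ[ℂ] G)
    (htm : ∀ (a c : H) (b d : M), ⟪tm a b, tm c d⟫ = ⟪a, c⟫ * ⟪b, d⟫)
    (tm' : K →ₗ[ℂ] M →ₗ[ℂ] G')
    (htm' : ∀ (a c : K) (b d : M), ⟪tm' a b, tm' c d⟫ = ⟪a, c⟫ * ⟪b, d⟫)
    (g : E →ₗ[ℂ] H) (f : E →ₗ[ℂ] K) {C : ℝ} (hC : 0 ≤ C) (hfg : ∀ e, ‖f e‖ ≤ C * ‖g e‖)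
    (t : E ⊗[ℂ] M) :
    ‖TensorProduct.lift (tm' ∘ₗ f) t‖ ≤ C * ‖TensorProduct.lift (tm ∘ₗ g) t‖ := by
  obtain ⟨N, hN, hs⟩ :=
    TensorProduct.exists_finite_submodule_right_of_setFinite {t} (Set.finite_singleton t)
  obtain ⟨t', rfl⟩ := hs rfl
  let u := stdOrthonormalBasis ℂ N
  obtain ⟨c, rfl⟩ := TensorProduct.eq_repr_basis_right u.toBasis t'
  have hu : Orthonormal ℂ (fun i => (u i : M)) :=
    u.orthonormal.comp_linearIsometry N.subtypeₗᵢ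
  rw [Finsupp.sum_fintype _ _ (by simp)]
  simp only [map_sum, LinearMap.lTensor_tmul, TensorProduct.lift.tmul, LinearMap.comp_apply,
    OrthonormalBasis.coe_toBasis, Submodule.subtype_apply]
  refine le_of_sq_le_sq ?_ (by positivity)
  rw [mul_pow, norm_sq_sum_tensor_orthonormal tm htm hu (fun i => g (c i)),
    norm_sq_sum_tensor_orthonormal tm' htm' hu (fun i => f (c i)), Finset.mul_sum]
  refine Finset.sum_le_sum fun i _ => ?_
  rw [← mul_pow]
  exact pow_le_pow_left₀ (norm_nonneg _) (hfg _) 2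

/-- A relation `C`-bounded in the first tensor factor stays `C`-bounded after closing its
ampliation. -/
lemma norm_snd_le_of_mem_closure_span (tm : H →ₗ[ℂ] M →ₗ[ℂ] G)
    (htm : ∀ (a c : H) (b d : M), ⟪tm a b, tm c d⟫ = ⟪a, c⟫ * ⟪b, d⟫)
    (tm' : K →ₗ[ℂ] M →ₗ[ℂ] G')
    (htm' : ∀ (a c : K) (b d : M), ⟪tm' a b, tm' c d⟫ = ⟪a, c⟫ * ⟪b, d⟫)
    (g : E →ₗ[ℂ] H) (f : E →ₗ[ℂ] K) {C : ℝ} (hC : 0 ≤ C) (hfg : ∀ e, ‖f e‖ ≤ C * ‖g e‖)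
    {p : G × G'} (hp : p ∈ (Submodule.span ℂ
      {p : G × G' | ∃ e b, p = (tm (g e) b, tm' (f e) b)}).topologicalClosure) :
    ‖p.2‖ ≤ C * ‖p.1‖ := by
  have hclosed : IsClosed {p : G × G' | ‖p.2‖ ≤ C * ‖p.1‖} :=
    isClosed_le (by fun_prop) (by fun_prop)
  refine closure_minimal ?_ hclosed hp
  have hle : Submodule.span ℂ {p : G × G' | ∃ e b, p = (tm (g e) b, tm' (f e) b)} ≤
      LinearMap.range
        ((TensorProduct.lift (tm ∘ₗ g)).prod (TensorProduct.lift (tm' ∘ₗ f))) := by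
    rw [Submodule.span_le]
    rintro _ ⟨e, b, rfl⟩
    exact ⟨e ⊗ₜ b, by simp⟩
  intro q hq
  obtain ⟨t, rfl⟩ := hle hq
  exact norm_lift_le_of_norm_le tm htm tm' htm' g f hC hfg t

lemma denseRange_lift (tm : H →ₗ[ℂ] M →ₗ[ℂ] G)
    (hd : Dense (Submodule.span ℂ {z : G | ∃ a b, z = tm a b} : Set G)) :
    DenseRange (TensorProduct.lift tm) := by
  refine hd.mono ?_
  have : Submodule.span ℂ {z : G | ∃ a b, z = tm a b} ≤
      LinearMap.range (TensorProduct.lift tm) := by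
    rw [Submodule.span_le]
    rintro _ ⟨a, b, rfl⟩
    exact ⟨a ⊗ₜ b, by simp⟩
  exact this

/-- Existence of the ampliation `A ⊗ I` of a bounded operator. -/
lemma exists_ampliation [CompleteSpace G'] (tm : H →ₗ[ℂ] M →ₗ[ℂ] G)
    (htm : ∀ (a c : H) (b d : M), ⟪tm a b, tm c d⟫ = ⟪a, c⟫ * ⟪b, d⟫)
    (hd : Dense (Submodule.span ℂ {z : G | ∃ a b, z = tm a b} : Set G))
    (tm' : K →ₗ[ℂ] M →ₗ[ℂ] G')
    (htm' : ∀ (a c : K) (b d : M), ⟪tm' a b, tm' c d⟫ = ⟪a, c⟫ * ⟪b, d⟫)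
    (A : H →L[ℂ] K) :
    ∃ L : G →L[ℂ] G', (∀ a b, L (tm a b) = tm' (A a) b) ∧ ∀ x, ‖L x‖ ≤ ‖A‖ * ‖x‖ := by
  have hb : ∀ t : H ⊗[ℂ] M, ‖TensorProduct.lift (tm' ∘ₗ A.toLinearMap) t‖ ≤
      ‖A‖ * ‖TensorProduct.lift tm t‖ := fun t =>
    norm_lift_le_of_norm_le tm htm tm' htm' LinearMap.id A.toLinearMap (norm_nonneg A)
      A.le_opNorm t
  refine ⟨(TensorProduct.lift (tm' ∘ₗ A.toLinearMap)).extendOfNorm (TensorProduct.lift tm),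
    fun a b => ?_, LinearMap.norm_extendOfNorm_apply_le (denseRange_lift tm hd) _ hb⟩
  simpa using LinearMap.extendOfNorm_eq (denseRange_lift tm hd) ⟨_, hb⟩ (a ⊗ₜ[ℂ] b)

lemma norm_tensor_apply (tm : H →ₗ[ℂ] M →ₗ[ℂ] G)
    (htm : ∀ (a c : H) (b d : M), ⟪tm a b, tm c d⟫ = ⟪a, c⟫ * ⟪b, d⟫) (a : H) (b : M) :
    ‖tm a b‖ = ‖a‖ * ‖b‖ := by
  have h := htm a a b b
  simp only [inner_self_eq_norm_sq_to_K] at h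
  have h' : ‖tm a b‖ ^ 2 = (‖a‖ * ‖b‖) ^ 2 := by
    rw [mul_pow]; exact_mod_cast h
  exact (sq_eq_sq₀ (norm_nonneg _) (by positivity)).mp h'

end TensorBound

section StrongConvergence

open Filter Topology

variable {H M G : Type*}
  [NormedAddCommGroup H] [InnerProductSpace ℂ H]
  [NormedAddCommGroup M] [InnerProductSpace ℂ M]
  [NormedAddCommGroup G] [InnerProductSpace ℂ G]

/-- Contractions converging strongly to the identity on a total set do so everywhere. -/
lemma tendsto_apply_of_dense_span (L : ℕ → G →L[ℂ] G) (hL : ∀ n, ‖L n‖ ≤ 1) {s : Set G}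
    (hs : Dense (Submodule.span ℂ s : Set G))
    (h : ∀ x ∈ s, Tendsto (fun n => L n x) atTop (𝓝 x)) (x : G) :
    Tendsto (fun n => L n x) atTop (𝓝 x) := by
  have hspan : ∀ y ∈ Submodule.span ℂ s, Tendsto (fun n => L n y) atTop (𝓝 y) := by
    intro y hy
    induction hy using Submodule.span_induction with
    | mem y hy => exact h y hy
    | zero => simp
    | add y z _ _ hy hz => simpa using hy.add hz
    | smul c y _ hy => simpa using hy.const_smul c
  rw [Metric.tendsto_atTop]
  intro ε hε
  obtain ⟨y, hy, hxy⟩ := Metric.mem_closure_iff.mp (hs x) (ε / 3) (by positivity)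
  obtain ⟨N, hN⟩ := Metric.tendsto_atTop.mp (hspan y hy) (ε / 3) (by positivity)
  refine ⟨N, fun n hn => ?_⟩
  have h1 : dist (L n x) (L n y) ≤ dist x y := by
    rw [dist_eq_norm, dist_eq_norm, ← map_sub]
    exact (L n).le_of_opNorm_le (hL n) _ |>.trans_eq (one_mul _)
  have h2 := hN n hn
  have h3 := dist_triangle4 (L n x) (L n y) y x
  rw [dist_comm y x] at h3
  linarith

lemma tendsto_ampliation (tm : H →ₗ[ℂ] M →ₗ[ℂ] G)
    (htm : ∀ (a c : H) (b d : M), ⟪tm a b, tm c d⟫ = ⟪a, c⟫ * ⟪b, d⟫)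
    (hd : Dense (Submodule.span ℂ {z : G | ∃ a b, z = tm a b} : Set G))
    (R : ℕ → H →L[ℂ] H) (hR : ∀ n, ‖R n‖ ≤ 1)
    (hconv : ∀ a, Tendsto (fun n => R n a) atTop (𝓝 a))
    (L : ℕ → G →L[ℂ] G) (hLtm : ∀ n a b, L n (tm a b) = tm (R n a) b)
    (hL : ∀ n x, ‖L n x‖ ≤ ‖R n‖ * ‖x‖) (x : G) :
    Tendsto (fun n => L n x) atTop (𝓝 x) := by
  refine tendsto_apply_of_dense_span L
    (fun n => ((L n).opNorm_le_bound (norm_nonneg _) (hL n)).trans (hR n)) hd ?_ x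
  rintro _ ⟨a, b, rfl⟩
  rw [tendsto_iff_norm_sub_tendsto_zero]
  have heq : ∀ n, ‖L n (tm a b) - tm a b‖ = ‖R n a - a‖ * ‖b‖ := fun n => by
    rw [hLtm, ← norm_tensor_apply tm htm, map_sub, LinearMap.sub_apply]
  simp only [heq]
  simpa using (tendsto_iff_norm_sub_tendsto_zero.mp (hconv a)).mul_const ‖b‖

end StrongConvergence

section Resolvent

open Filter Topology

variable {H K : Type*}
  [NormedAddCommGroup H] [InnerProductSpace ℂ H] [CompleteSpace H]
  [NormedAddCommGroup K] [InnerProductSpace ℂ K] [CompleteSpace K]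

/-- The operators `R = (1 + δ²T*T)⁻¹`, `B = T R` and `S = (1 + δ²TT*)⁻¹`, read off from the
orthogonal projection onto the graph of `δ T`. -/
lemma exists_resolvents (T : H →ₗ.[ℂ] K) (hT : T.IsClosed) {δ : ℝ} (hδ : 0 < δ) :
    ∃ (R : H →L[ℂ] H) (B : H →L[ℂ] K) (S : K →L[ℂ] K),
      (∀ a, (R a, B a) ∈ T.graph) ∧ (∀ a b, (a, b) ∈ T.graph → S b = B a) ∧
      ‖R‖ ≤ 1 ∧ ‖S‖ ≤ 1 ∧ (∀ a b, (a, b) ∈ T.graph → ‖R a - a‖ ≤ δ * ‖b‖) ∧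
      (∀ c w, (∀ v u, (v, u) ∈ T.graph → ⟪v, c⟫ + ⟪u, w⟫ = 0) → ‖S w - w‖ ≤ δ * ‖c‖) := by
  obtain ⟨d, hd0, hdc, hdn⟩ : ∃ d : ℂ, d ≠ 0 ∧ (starRingEnd ℂ) d = d ∧ ‖d‖ = δ :=
    ⟨δ, by exact_mod_cast hδ.ne', Complex.conj_ofReal δ, by
      rw [Complex.norm_real, Real.norm_of_nonneg hδ.le]⟩
  let Φ : WithLp 2 (H × K) →L[ℂ] H × K :=
    (WithLp.fstL 2 ℂ H K).prod (d⁻¹ • WithLp.sndL 2 ℂ H K)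
  let V : Submodule ℂ (WithLp 2 (H × K)) := T.graph.comap Φ.toLinearMap
  have hVmem : ∀ p : WithLp 2 (H × K), p ∈ V ↔ (p.fst, d⁻¹ • p.snd) ∈ T.graph :=
    fun _ => Iff.rfl
  have hVclosed : IsClosed (V : Set (WithLp 2 (H × K))) := hT.preimage Φ.continuous
  have : CompleteSpace V := hVclosed.completeSpace_coe
  let ι₁ : H →L[ℂ] WithLp 2 (H × K) :=
    (WithLp.prodContinuousLinearEquiv 2 ℂ H K).symm.toContinuousLinearMap ∘L
      ContinuousLinearMap.inl ℂ H K
  let ι₂ : K →L[ℂ] WithLp 2 (H × K) :=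
    (WithLp.prodContinuousLinearEquiv 2 ℂ H K).symm.toContinuousLinearMap ∘L
      ContinuousLinearMap.inr ℂ H K
  have hι₁ : ∀ a, ι₁ a = WithLp.toLp 2 (a, 0) := fun _ => rfl
  have hι₂ : ∀ b, ι₂ b = WithLp.toLp 2 (0, b) := fun _ => rfl
  have nι₁ : ∀ a, ‖ι₁ a‖ = ‖a‖ := fun a => by simp [hι₁]
  have nι₂ : ∀ b, ‖ι₂ b‖ = ‖b‖ := fun b => by simp [hι₂]
  have nfst : ∀ p : WithLp 2 (H × K), ‖p.fst‖ ≤ ‖p‖ := WithLp.norm_fst_le H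
  have nsnd : ∀ p : WithLp 2 (H × K), ‖p.snd‖ ≤ ‖p‖ := WithLp.norm_snd_le H
  have nproj : ∀ (W : Submodule ℂ (WithLp 2 (H × K))) [W.HasOrthogonalProjection] p,
      ‖W.starProjection p‖ ≤ ‖p‖ := fun W _ p =>
    (W.starProjection.le_of_opNorm_le W.starProjection_norm_le p).trans_eq (one_mul _)
  have hcompl : ∀ p, Vᗮ.starProjection p = p - V.starProjection p := fun p => by
    rw [Submodule.starProjection_orthogonal_val]
  refine ⟨WithLp.fstL 2 ℂ H K ∘L V.starProjection ∘L ι₁,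
    d⁻¹ • (WithLp.sndL 2 ℂ H K ∘L V.starProjection ∘L ι₁),
    WithLp.sndL 2 ℂ H K ∘L Vᗮ.starProjection ∘L ι₂, ?_, ?_, ?_, ?_, ?_, ?_⟩
  · intro a
    exact (hVmem _).mp (V.starProjection_apply_mem (ι₁ a))
  · intro a b hab
    have hmem : ι₁ a + d • ι₂ b ∈ V := by
      rw [hVmem]
      simpa [hι₁, hι₂, smul_smul, hd0] using hab
    have h1 := Submodule.starProjection_eq_self_iff.mpr hmem
    rw [map_add, map_smul] at h1
    have h2 : d • Vᗮ.starProjection (ι₂ b) = V.starProjection (ι₁ a) - ι₁ a := by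
      rw [hcompl, smul_sub]
      linear_combination (norm := module) -h1
    have h3 := congrArg (fun p => d⁻¹ • p.snd) h2
    simpa [hι₁, smul_smul, hd0] using h3
  · refine ContinuousLinearMap.opNorm_le_bound _ zero_le_one fun a => ?_
    rw [one_mul, ← nι₁ a]
    exact (nfst _).trans (nproj V _)
  · refine ContinuousLinearMap.opNorm_le_bound _ zero_le_one fun b => ?_
    rw [one_mul, ← nι₂ b]
    exact (nsnd _).trans (nproj Vᗮ _)
  · intro a b hab
    have hmem : ι₁ a + d • ι₂ b ∈ V := by
      rw [hVmem]
      simpa [hι₁, hι₂, smul_smul, hd0] using hab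
    have h1 := Submodule.starProjection_eq_self_iff.mpr hmem
    rw [map_add, map_smul] at h1
    have h2 : V.starProjection (ι₁ a) - ι₁ a = d • Vᗮ.starProjection (ι₂ b) := by
      rw [hcompl, smul_sub]
      linear_combination (norm := module) h1
    calc _ = ‖(V.starProjection (ι₁ a) - ι₁ a).fst‖ := rfl
      _ ≤ _ := nfst _
      _ = δ * ‖Vᗮ.starProjection (ι₂ b)‖ := by
        rw [h2, norm_smul, hdn]
      _ ≤ δ * ‖b‖ := by
        have := nproj Vᗮ (ι₂ b)
        rw [nι₂] at this
        gcongr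
  · intro c w hcw
    have hmem : d • ι₁ c + ι₂ w ∈ Vᗮ := by
      rw [Submodule.mem_orthogonal]
      intro p hp
      have h := hcw _ _ ((hVmem p).mp hp)
      rw [inner_smul_left, map_inv₀, hdc] at h
      have h' : d * ⟪p.fst, c⟫ + ⟪p.snd, w⟫ = 0 := by
        field_simp at h
        linear_combination h
      simpa [hι₁, hι₂, WithLp.prod_inner_apply, inner_smul_right] using h'
    have h1 := V.starProjection_apply_eq_zero_iff.mpr hmem
    rw [map_add, map_smul] at h1
    have h2 : Vᗮ.starProjection (ι₂ w) - ι₂ w = d • V.starProjection (ι₁ c) := by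
      rw [hcompl]
      linear_combination (norm := module) -h1
    calc _ = ‖(Vᗮ.starProjection (ι₂ w) - ι₂ w).snd‖ := rfl
      _ ≤ _ := nsnd _
      _ = δ * ‖V.starProjection (ι₁ c)‖ := by
        rw [h2, norm_smul, hdn]
      _ ≤ δ * ‖c‖ := by
        have := nproj V (ι₁ c)
        rw [nι₁] at this
        gcongr

/-- The vectors in the domain of the adjoint of a closed operator are dense. -/
lemma dense_adjoint_domain (T : H →ₗ.[ℂ] K) (hT : T.IsClosed) :
    Dense (Submodule.span ℂ
      {w : K | ∃ c : H, ∀ v u, (v, u) ∈ T.graph → ⟪v, c⟫ + ⟪u, w⟫ = 0} : Set K) := by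
  rw [Submodule.dense_iff_topologicalClosure_eq_top,
    Submodule.topologicalClosure_eq_top_iff, Submodule.eq_bot_iff]
  intro b hb
  let V : Submodule ℂ (WithLp 2 (H × K)) :=
    T.graph.comap (WithLp.prodContinuousLinearEquiv 2 ℂ H K).toLinearMap
  have hVclosed : IsClosed (V : Set (WithLp 2 (H × K))) :=
    hT.preimage (WithLp.prodContinuousLinearEquiv 2 ℂ H K).continuous
  have : CompleteSpace V := hVclosed.completeSpace_coe
  have hmem : WithLp.toLp 2 ((0 : H), b) ∈ Vᗮᗮ := by
    rw [Submodule.mem_orthogonal]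
    intro q hq
    have h := (Submodule.mem_orthogonal _ _).mp hb q.snd (Submodule.subset_span ⟨q.fst, ?_⟩)
    · simpa [WithLp.prod_inner_apply] using h
    · intro v u hvu
      exact (Submodule.mem_orthogonal _ _).mp hq (WithLp.toLp 2 (v, u)) hvu
  rw [Submodule.orthogonal_orthogonal] at hmem
  exact T.graph_fst_eq_zero_snd hmem rfl

/-- Bounded regularisations of a closed densely defined operator. -/
lemma exists_approximation (T : H →ₗ.[ℂ] K) (hT : T.IsClosed)
    (hd : Dense (T.domain : Set H)) :
    ∃ (R : ℕ → H →L[ℂ] H) (B : ℕ → H →L[ℂ] K) (S : ℕ → K →L[ℂ] K),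
      (∀ n a, (R n a, B n a) ∈ T.graph) ∧ (∀ n a b, (a, b) ∈ T.graph → S n b = B n a) ∧
      (∀ n, ‖R n‖ ≤ 1) ∧ (∀ n, ‖S n‖ ≤ 1) ∧ (∀ a, Tendsto (fun n => R n a) atTop (𝓝 a)) ∧
      (∀ b, Tendsto (fun n => S n b) atTop (𝓝 b)) := by
  choose R B S hRB hSB hR hS hRc hSc using fun n : ℕ =>
    exists_resolvents T hT (δ := 1 / ((n : ℝ) + 1)) Nat.one_div_pos_of_nat
  have hlim : ∀ r : ℝ, Tendsto (fun n : ℕ => 1 / ((n : ℝ) + 1) * r) atTop (𝓝 0) := fun r => by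
    simpa using tendsto_one_div_add_atTop_nhds_zero_nat.mul_const r
  refine ⟨R, B, S, hRB, hSB, hR, hS, ?_, ?_⟩
  · refine tendsto_apply_of_dense_span R hR (s := T.domain) (by simpa using hd) fun a ha => ?_
    rw [tendsto_iff_norm_sub_tendsto_zero]
    exact squeeze_zero (fun _ => norm_nonneg _)
      (fun n => hRc n a _ (T.mem_graph ⟨a, ha⟩)) (hlim _)
  · refine tendsto_apply_of_dense_span S hS (dense_adjoint_domain T hT) ?_
    rintro w ⟨c, hc⟩
    rw [tendsto_iff_norm_sub_tendsto_zero]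
    exact squeeze_zero (fun _ => norm_nonneg _) (fun n => hSc n c w hc) (hlim _)

end Resolvent

lemma mem_graph_pmapComp {E F G : Type*}
    [NormedAddCommGroup E] [InnerProductSpace ℂ E]
    [NormedAddCommGroup F] [InnerProductSpace ℂ F]
    [NormedAddCommGroup G] [InnerProductSpace ℂ G]
    (Q : F →ₗ.[ℂ] G) (P : E →ₗ.[ℂ] F) (p : E × G) :
    p ∈ (pmapComp Q P).graph ↔ ∃ y : F, (p.1, y) ∈ P.graph ∧ (y, p.2) ∈ Q.graph := by
  unfold pmapComp
  rw [Submodule.toLinearPMap_graph_eq]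
  · rfl
  · rintro x ⟨y, hP, hQ⟩ hx
    exact Q.graph_fst_eq_zero_snd hQ (P.graph_fst_eq_zero_snd hP hx)

lemma mapsTo_topologicalClosure_span {E F : Type*}
    [NormedAddCommGroup E] [NormedSpace ℂ E] [NormedAddCommGroup F] [NormedSpace ℂ F]
    (Φ : E →L[ℂ] F) {s : Set E} {W : Submodule ℂ F} (hW : IsClosed (W : Set F))
    (h : ∀ x ∈ s, Φ x ∈ W) {x : E} (hx : x ∈ (Submodule.span ℂ s).topologicalClosure) :
    Φ x ∈ W := by
  have hle : (Submodule.span ℂ s).topologicalClosure ≤ W.comap Φ.toLinearMap :=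
    Submodule.topologicalClosure_minimal _ (Submodule.span_le.mpr h)
      (hW.preimage Φ.continuous)
  exact hle hx

theorem stmt18 {H₁ H₂ H₁' H₂' GA GB GC : Type*}
    [NormedAddCommGroup H₁] [InnerProductSpace ℂ H₁] [CompleteSpace H₁]
    [NormedAddCommGroup H₂] [InnerProductSpace ℂ H₂] [CompleteSpace H₂]
    [NormedAddCommGroup H₁'] [InnerProductSpace ℂ H₁'] [CompleteSpace H₁']
    [NormedAddCommGroup H₂'] [InnerProductSpace ℂ H₂'] [CompleteSpace H₂']
    [NormedAddCommGroup GA] [InnerProductSpace ℂ GA] [CompleteSpace GA]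
    [NormedAddCommGroup GB] [InnerProductSpace ℂ GB] [CompleteSpace GB]
    [NormedAddCommGroup GC] [InnerProductSpace ℂ GC] [CompleteSpace GC]
    -- `GA = H₁ ⊗ H₂`, `GB = H₁ ⊗ H₂'`, `GC = H₁' ⊗ H₂'`:
    (tmA : H₁ →ₗ[ℂ] H₂ →ₗ[ℂ] GA)
    (htmA_inner : ∀ (a c : H₁) (b d : H₂), ⟪tmA a b, tmA c d⟫ = ⟪a, c⟫ * ⟪b, d⟫)
    (htmA_dense : Dense (Submodule.span ℂ {z : GA | ∃ a b, z = tmA a b} : Set GA))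
    (tmB : H₁ →ₗ[ℂ] H₂' →ₗ[ℂ] GB)
    (htmB_inner : ∀ (a c : H₁) (b d : H₂'), ⟪tmB a b, tmB c d⟫ = ⟪a, c⟫ * ⟪b, d⟫)
    (htmB_dense : Dense (Submodule.span ℂ {z : GB | ∃ a b, z = tmB a b} : Set GB))
    (tmC : H₁' →ₗ[ℂ] H₂' →ₗ[ℂ] GC)
    (htmC_inner : ∀ (a c : H₁') (b d : H₂'), ⟪tmC a b, tmC c d⟫ = ⟪a, c⟫ * ⟪b, d⟫)
    (htmC_dense : Dense (Submodule.span ℂ {z : GC | ∃ a b, z = tmC a b} : Set GC))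
    (T₁ : H₁ →ₗ.[ℂ] H₁') (T₂ : H₂ →ₗ.[ℂ] H₂')
    (h₁closed : T₁.IsClosed) (h₂closed : T₂.IsClosed)
    (h₁dense : Dense (T₁.domain : Set H₁)) (h₂dense : Dense (T₂.domain : Set H₂))
    -- `T = T₁ ⊗ T₂`:
    (T : GA →ₗ.[ℂ] GC)
    (hT : T.graph = (Submodule.span ℂ
      {p : GA × GC | ∃ (x : T₁.domain) (y : T₂.domain),
        p = (tmA (x : H₁) (y : H₂), tmC (T₁ x) (T₂ y))}).topologicalClosure)
    -- `P = I_{H₁} ⊗ T₂ : GA → GB`: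
    (P : GA →ₗ.[ℂ] GB)
    (hP : P.graph = (Submodule.span ℂ
      {p : GA × GB | ∃ (x : H₁) (y : T₂.domain),
        p = (tmA x (y : H₂), tmB x (T₂ y))}).topologicalClosure)
    -- `Q = T₁ ⊗ I_{H₂'} : GB → GC`:
    (Q : GB →ₗ.[ℂ] GC)
    (hQ : Q.graph = (Submodule.span ℂ
      {p : GB × GC | ∃ (x : T₁.domain) (y : H₂'),
        p = (tmB (x : H₁) y, tmC (T₁ x) y)}).topologicalClosure) :
    -- `T₁ ⊗ T₂` is the closure of `(T₁ ⊗ I)(I ⊗ T₂)`: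
    ((pmapComp Q P).IsClosable ∧ (pmapComp Q P).closure = T) ∧
    -- if `T₁` is injective with bounded inverse, or `T₂` is bounded, then
    -- `(T₁ ⊗ I)(I ⊗ T₂)` is closed and equals `T₁ ⊗ T₂`:
    (((∃ c > (0:ℝ), ∀ x : T₁.domain, c * ‖(x : H₁)‖ ≤ ‖T₁ x‖) ∨
        (∃ C : ℝ, ∀ y : T₂.domain, ‖T₂ y‖ ≤ C * ‖(y : H₂)‖)) →
      (pmapComp Q P).IsClosed ∧ pmapComp Q P = T) := by
  
  have hTclosed : T.IsClosed := by
    rw [LinearPMap.IsClosed, hT]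
    exact Submodule.isClosed_topologicalClosure _
  have hPclosed : P.IsClosed := by
    rw [LinearPMap.IsClosed, hP]
    exact Submodule.isClosed_topologicalClosure _
  have hQclosed : Q.IsClosed := by
    rw [LinearPMap.IsClosed, hQ]
    exact Submodule.isClosed_topologicalClosure _
  have hTmem : ∀ (a : H₁) (a' : H₁') (y : T₂.domain), (a, a') ∈ T₁.graph →
      (tmA a y, tmC a' (T₂ y)) ∈ T.graph := by
    intro a a' y h
    obtain ⟨x, rfl, rfl⟩ := T₁.mem_graph_iff.mp h
    rw [hT]
    exact Submodule.le_topologicalClosure _ (Submodule.subset_span ⟨x, y, rfl⟩)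
  have hcompT : (pmapComp Q P).graph ≤ T.graph := by
    rintro ⟨x, z⟩ hxz
    obtain ⟨y, hxy, hyz⟩ := (mem_graph_pmapComp Q P _).mp hxz
    obtain ⟨R, B, S, hRB, hSB, hR, hS, hRc, hSc⟩ := exists_approximation T₁ h₁closed h₁dense
    choose L hLtm hL using fun n =>
      exists_ampliation tmA htmA_inner htmA_dense tmA htmA_inner (R n)
    choose M hMtm hM using fun n =>
      exists_ampliation tmB htmB_inner htmB_dense tmC htmC_inner (B n)
    choose N hNtm hN using fun n =>
      exists_ampliation tmC htmC_inner htmC_dense tmC htmC_inner (S n)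
    have hLM : ∀ n, (L n x, M n y) ∈ T.graph := by
      intro n
      rw [hP] at hxy
      refine mapsTo_topologicalClosure_span ((L n).prodMap (M n)) hTclosed ?_ hxy
      rintro _ ⟨a, b, rfl⟩
      simpa [hLtm, hMtm] using hTmem _ _ b (hRB n a)
    have hMN : ∀ n, M n y = N n z := by
      intro n
      rw [hQ] at hyz
      have hmem := mapsTo_topologicalClosure_span (W := ⊥)
        (M n ∘L ContinuousLinearMap.fst ℂ GB GC - N n ∘L ContinuousLinearMap.snd ℂ GB GC)
        (by simp) ?_ hyz
      · simpa [sub_eq_zero] using hmem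
      · rintro _ ⟨a, b, rfl⟩
        simp [hMtm, hNtm, hSB n _ _ (T₁.mem_graph a)]
    have hlim := (tendsto_ampliation tmA htmA_inner htmA_dense R hR hRc L hLtm hL x).prodMk_nhds
      (tendsto_ampliation tmC htmC_inner htmC_dense S hS hSc N hNtm hN z)
    exact hTclosed.mem_of_tendsto hlim
      (Filter.Eventually.of_forall fun n => by simpa [hMN] using hLM n)
  have hTcomp : T.graph ≤ (pmapComp Q P).graph.topologicalClosure := by
    rw [hT]
    refine Submodule.topologicalClosure_mono (Submodule.span_le.mpr ?_)
    rintro _ ⟨a, b, rfl⟩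
    refine (mem_graph_pmapComp Q P _).mpr ⟨tmB a (T₂ b), ?_, ?_⟩
    · rw [hP]
      exact Submodule.le_topologicalClosure _ (Submodule.subset_span ⟨a, b, rfl⟩)
    · rw [hQ]
      exact Submodule.le_topologicalClosure _ (Submodule.subset_span ⟨a, T₂ b, rfl⟩)
  have hgraph : (pmapComp Q P).graph.topologicalClosure = T.graph :=
    le_antisymm (Submodule.topologicalClosure_minimal _ hcompT hTclosed) hTcomp
  have hclosable : (pmapComp Q P).IsClosable := ⟨T, hgraph⟩
  refine ⟨⟨hclosable, LinearPMap.eq_of_eq_graph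
    (hclosable.graph_closure_eq_closure_graph.symm.trans hgraph)⟩, fun hbdd => ?_⟩
  have hcomp : ∃ C : ℝ, 0 ≤ C ∧ ∀ x y z, (x, y) ∈ P.graph → (y, z) ∈ Q.graph →
      ‖y‖ ≤ C * ‖(x, z)‖ := by
    rcases hbdd with ⟨c, hc, hbound⟩ | ⟨C, hbound⟩
    · refine ⟨c⁻¹, by positivity, fun x y z _ hyz => ?_⟩
      have hyz' : (z, y) ∈ (Submodule.span ℂ {p : GC × GB | ∃ (e : T₁.domain) (b : H₂'),
          p = (tmC (T₁.toFun e) b, tmB (T₁.domain.subtype e) b)}).topologicalClosure := by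
        rw [hQ] at hyz
        refine mapsTo_topologicalClosure_span
          (ContinuousLinearEquiv.prodComm ℂ GB GC).toContinuousLinearMap
          (Submodule.isClosed_topologicalClosure _) ?_ hyz
        rintro _ ⟨a, b, rfl⟩
        exact Submodule.le_topologicalClosure _ (Submodule.subset_span ⟨a, b, rfl⟩)
      have h := norm_snd_le_of_mem_closure_span tmC htmC_inner tmB htmB_inner T₁.toFun
        T₁.domain.subtype (inv_nonneg.mpr hc.le)
        (fun e => by rw [inv_mul_eq_div, le_div_iff₀' hc]; exact hbound e) hyz'
      exact h.trans (by gcongr; exact norm_snd_le (x, z))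
    · refine ⟨|C|, abs_nonneg C, fun x y z hxy _ => ?_⟩
      have hxy' : (x, y) ∈ (Submodule.span ℂ {p : GA × GB | ∃ (e : T₂.domain) (b : H₁),
          p = (tmA.flip (T₂.domain.subtype e) b,
            tmB.flip (T₂.toFun e) b)}).topologicalClosure := by
        rw [hP] at hxy
        refine Submodule.topologicalClosure_mono (Submodule.span_mono ?_) hxy
        rintro _ ⟨a, b, rfl⟩
        exact ⟨b, a, rfl⟩
      have h := norm_snd_le_of_mem_closure_span tmA.flip
        (fun a c b d => by simp [htmA_inner, mul_comm]) tmB.flip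
        (fun a c b d => by simp [htmB_inner, mul_comm]) T₂.domain.subtype T₂.toFun
        (abs_nonneg C)
        (fun e => (hbound e).trans (by gcongr; exacts [le_abs_self C, le_rfl])) hxy'
      exact h.trans (by gcongr; exact norm_fst_le (x, z))
  have hclosed : (pmapComp Q P).IsClosed := by
    obtain ⟨C, hC, hbound⟩ := hcomp
    refine IsSeqClosed.isClosed fun p q hp hlim => ?_
    choose y hxy hyz using fun n => (mem_graph_pmapComp Q P _).mp (hp n)
    have hcauchy : CauchySeq y := by
      rw [Metric.cauchySeq_iff']
      intro ε hε
      obtain ⟨N, hN⟩ := Metric.cauchySeq_iff'.mp hlim.cauchySeq (ε / (C + 1)) (by positivity)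
      refine ⟨N, fun n hn => ?_⟩
      have h1 := hbound _ _ _ (P.graph.sub_mem (hxy n) (hxy N))
        (Q.graph.sub_mem (hyz n) (hyz N))
      have h2 := hN n hn
      rw [dist_eq_norm, lt_div_iff₀ (by positivity)] at h2
      rw [dist_eq_norm]
      have h3 : ‖y n - y N‖ ≤ C * ‖p n - p N‖ := h1
      nlinarith [norm_nonneg (p n - p N)]
    obtain ⟨y₀, hy₀⟩ := cauchySeq_tendsto_of_complete hcauchy
    refine (mem_graph_pmapComp Q P q).mpr ⟨y₀, ?_, ?_⟩
    · exact hPclosed.mem_of_tendsto (hlim.fst_nhds.prodMk_nhds hy₀)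
        (Filter.Eventually.of_forall hxy)
    · exact hQclosed.mem_of_tendsto (hy₀.prodMk_nhds hlim.snd_nhds)
        (Filter.Eventually.of_forall hyz)
  exact ⟨hclosed, LinearPMap.eq_of_eq_graph
    (hclosed.submodule_topologicalClosure_eq.symm.trans hgraph)⟩
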